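/- Let h:ℝ²→ℝ be supermodular and either increasing in each component or decreasing in each component. Then for any two vectors x, y ∈ ℝⁿ, the vector (h(x_[1], y_[n]), h(x_[2], y_[n−1]), …, h(x_[n], y_[1])), obtained by applying h to oppositely ordered rearrangements of x and y, is weakly submajorized by the vector (h(x₁,y₁),…,h(x_n,y_n)); that is, (h(x_[1],y_[n]),…,h(x_[n],y_[1])) ≺_w (h(x₁,y₁),…,h(x_n,y_n)). -/

import Mathlib

/-- Decreasing rearrangement of a vector. -/
noncomputable def decSort {n : ℕ} (x : Fin n → ℝ) : Fin n → ℝ :=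
  fun i => x (Tuple.sort x i.rev)

/-- Increasing rearrangement of a vector. -/
noncomputable def incSort {n : ℕ} (x : Fin n → ℝ) : Fin n → ℝ :=
  fun i => x (Tuple.sort x i)

/-- Sum of the `k` largest components. -/
noncomputable def topSum {n : ℕ} (k : ℕ) (x : Fin n → ℝ) : ℝ :=
  ∑ i ∈ Finset.univ.filter (fun i : Fin n => (i : ℕ) < k), decSort x i

/-- Sum of the `k` smallest components. -/
noncomputable def botSum {n : ℕ} (k : ℕ) (x : Fin n → ℝ) : ℝ :=
  ∑ i ∈ Finset.univ.filter (fun i : Fin n => (i : ℕ) < k), incSort x i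

/-- `x ≺ y` : majorization. -/
def Maj {n : ℕ} (x y : Fin n → ℝ) : Prop :=
  (∀ k < n, topSum k x ≤ topSum k y) ∧ (∑ i, x i = ∑ i, y i)

/-- `x ≺_w y` : weak submajorization. -/
def WSubMaj {n : ℕ} (x y : Fin n → ℝ) : Prop :=
  ∀ k ≤ n, topSum k x ≤ topSum k y

/-- `x ≺^w y` : weak supermajorization. -/
def WSupMaj {n : ℕ} (x y : Fin n → ℝ) : Prop :=
  ∀ k ≤ n, botSum k y ≤ botSum k x

/-- Schur-convexity. -/
def SchurConvex {n : ℕ} (φ : (Fin n → ℝ) → ℝ) : Prop :=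
  ∀ x y, Maj x y → φ x ≤ φ y

/-- `Y` is obtained from `X` by permuting the entries within each column. -/
def InPermSet {n d : ℕ} (X Y : Fin n → Fin d → ℝ) : Prop :=
  ∀ i : Fin d, ∃ π : Equiv.Perm (Fin n), ∀ k, Y k i = X (π k) i

/-- `x` and `y` are oppositely ordered. -/
def OppOrd {n : ℕ} (x y : Fin n → ℝ) : Prop :=
  ∀ k l, (x k - x l) * (y k - y l) ≤ 0

/-- Supermodularity for functions of two real variables. -/
def Supermod2 (h : ℝ → ℝ → ℝ) : Prop :=
  ∀ a a' b b', h a b + h a' b' ≤ h (min a a') (min b b') + h (max a a') (max b b')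

/-- Supermodularity for functions on `ℝ^m`. -/
def SupermodPi {m : ℕ} (h : (Fin m → ℝ) → ℝ) : Prop :=
  ∀ x y, h x + h y ≤ h (x ⊓ y) + h (x ⊔ y)

/-- `h` is strictly monotone in each component. -/
def StrictCompMono {m : ℕ} (h : (Fin m → ℝ) → ℝ) : Prop :=
  ∀ i : Fin m,
    (∀ x : Fin m → ℝ, StrictMono fun t => h (Function.update x i t)) ∨
    (∀ x : Fin m → ℝ, StrictAnti fun t => h (Function.update x i t))

/-- Rearrangement inequality for supermodular functions: the opposite ordering minimises. -/
theorem Supermod2.sum_le_sum_comp_perm {ι : Type*} [Fintype ι] [LinearOrder ι]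
    {g : ℝ → ℝ → ℝ} (hg : Supermod2 g) {a b : ι → ℝ} (ha : Antitone a) (hb : Monotone b)
    (σ : Equiv.Perm ι) : ∑ i, g (a i) (b i) ≤ ∑ i, g (a i) (b (σ i)) := by
  suffices H : ∀ (s : Finset ι) (σ : Equiv.Perm ι), (∀ i, σ i ≠ i → i ∈ s) →
      ∑ i, g (a i) (b i) ≤ ∑ i, g (a i) (b (σ i)) from
    H Finset.univ σ fun i _ => Finset.mem_univ i
  intro s
  induction s using Finset.induction_on_max with
  | empty =>
    intro σ hσ
    refine Finset.sum_le_sum fun i _ => ?_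
    by_cases hi : σ i = i
    · rw [hi]
    · exact absurd (hσ i hi) (Finset.notMem_empty i)
  | insert p s hp ih =>
    intro σ hσ
    by_cases hσp : σ p = p
    · refine ih σ fun i hi => (Finset.mem_insert.1 (hσ i hi)).resolve_left ?_
      rintro rfl
      exact hi hσp
    have le_p : ∀ i, σ i ≠ i → i ≤ p := fun i hi =>
      (Finset.mem_insert.1 (hσ i hi)).elim le_of_eq fun h => (hp i h).le
    set r := σ.symm p
    have hσr : σ r = p := σ.apply_symm_apply p
    have hrp : r ≠ p := fun h => hσp (h ▸ hσr)
    have har : a p ≤ a r := ha (le_p r (hσr ▸ hrp.symm))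
    have hbq : b (σ p) ≤ b p := hb (le_p (σ p) fun h => hσp (σ.injective h))
    refine (ih (Equiv.swap p (σ p) * σ) fun i hi => ?_).trans ?_
    · have hip : i ≠ p := by
        rintro rfl
        exact hi (by simp)
      by_contra his
      have hσi : σ i = i := by
        by_contra h
        exact his ((Finset.mem_insert.1 (hσ i h)).resolve_left hip)
      refine hi ?_
      rw [Equiv.Perm.mul_apply, hσi, Equiv.swap_apply_of_ne_of_ne hip]
      intro h
      exact hip (σ.injective (hσi.trans h))
    · have hr_mem : r ∈ Finset.univ.erase p := by simp [hrp]
      rw [← Finset.add_sum_erase _ _ (Finset.mem_univ p),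
        ← Finset.add_sum_erase _ (fun i => g (a i) (b (σ i))) (Finset.mem_univ p),
        ← Finset.add_sum_erase _ _ hr_mem,
        ← Finset.add_sum_erase _ (fun i => g (a i) (b (σ i))) hr_mem,
        ← add_assoc, ← add_assoc]
      refine add_le_add ?_ (Finset.sum_le_sum fun i hi => ?_)
      · have := hg (a p) (a r) (b p) (b (σ p))
        rw [min_eq_left har, max_eq_right har, min_eq_right hbq, max_eq_left hbq] at this
        simpa [hσr] using this
      · have hir : i ≠ r := Finset.ne_of_mem_erase hi
        have hip : i ≠ p := Finset.ne_of_mem_erase (Finset.mem_of_mem_erase hi)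
        rw [Equiv.Perm.mul_apply, Equiv.swap_apply_of_ne_of_ne]
        · intro h
          exact hir (σ.injective (h.trans hσr.symm))
        · exact fun h => hip (σ.injective h)

theorem incSort_monotone {n : ℕ} (x : Fin n → ℝ) : Monotone (incSort x) :=
  Tuple.monotone_sort x

theorem decSort_antitone {n : ℕ} (x : Fin n → ℝ) : Antitone (decSort x) :=
  fun _ _ hij => incSort_monotone x (Fin.rev_le_rev.2 hij)

theorem sum_comp_decSort {n : ℕ} (f : ℝ → ℝ) (x : Fin n → ℝ) :
    ∑ i, f (decSort x i) = ∑ i, f (x i) :=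
  (Fin.revPerm.trans (Tuple.sort x)).sum_comp fun i => f (x i)

theorem Supermod2.sum_decSort_incSort_le {n : ℕ} {g : ℝ → ℝ → ℝ} (hg : Supermod2 g)
    (x y : Fin n → ℝ) :
    ∑ i, g (decSort x i) (incSort y i) ≤ ∑ i, g (x i) (y i) := by
  let τ : Equiv.Perm (Fin n) := Fin.revPerm.trans (Tuple.sort x)
  refine (hg.sum_le_sum_comp_perm (decSort_antitone x) (incSort_monotone y)
    (τ.trans (Tuple.sort y).symm)).trans_eq ?_
  rw [← Equiv.sum_comp τ fun i => g (x i) (y i)]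
  simp [τ, decSort, incSort]

/-- The positive part of a shift of a monotone supermodular function is supermodular. -/
theorem Supermod2.max_sub_zero {h : ℝ → ℝ → ℝ} (hsm : Supermod2 h)
    (hdir : ((∀ b, Monotone fun a => h a b) ∧ ∀ a, Monotone fun b => h a b) ∨
            ((∀ b, Antitone fun a => h a b) ∧ ∀ a, Antitone fun b => h a b))
    (t : ℝ) : Supermod2 fun a b => max (h a b - t) 0 := by
  have key : ∀ {u v m M : ℝ}, u ≤ M → v ≤ M → u + v ≤ m + M →
      max (u - t) 0 + max (v - t) 0 ≤ max (m - t) 0 + max (M - t) 0 := by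
    intro u v m M hu hv huv
    rcases max_cases (u - t) 0 with hu' | hu' <;> rcases max_cases (v - t) 0 with hv' | hv' <;>
      linarith [le_max_left (m - t) 0, le_max_right (m - t) 0,
        le_max_left (M - t) 0, le_max_right (M - t) 0]
  intro a a' b b'
  have hsum := hsm a a' b b'
  rcases hdir with ⟨h₁, h₂⟩ | ⟨h₁, h₂⟩
  · exact key ((h₁ b (le_max_left a a')).trans (h₂ _ (le_max_left b b')))
      ((h₁ b' (le_max_right a a')).trans (h₂ _ (le_max_right b b'))) hsum
  · rw [add_comm (max (h (min a a') _ - t) 0)]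
    exact key ((h₁ b (min_le_left a a')).trans (h₂ _ (min_le_left b b')))
      ((h₁ b' (min_le_right a a')).trans (h₂ _ (min_le_right b b')))
      (hsum.trans_eq (add_comm _ _))

theorem topSum_eq_mul_add {n k : ℕ} (hk : k ≤ n) (u : Fin n → ℝ) (t : ℝ) :
    topSum k u = k * t +
      ∑ i ∈ Finset.univ.filter (fun i : Fin n => (i : ℕ) < k), (decSort u i - t) := by
  have hcard : (Finset.univ.filter fun i : Fin n => (i : ℕ) < k).card = k := by
    rw [Fin.card_filter_val_lt, min_eq_right hk]
  rw [Finset.sum_sub_distrib, Finset.sum_const, hcard, nsmul_eq_mul, topSum]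
  ring

theorem topSum_le_mul_add_sum {n k : ℕ} (hk : k ≤ n) (u : Fin n → ℝ) (t : ℝ) :
    topSum k u ≤ k * t + ∑ i, max (u i - t) 0 := by
  rw [topSum_eq_mul_add hk u t, ← sum_comp_decSort (fun z => max (z - t) 0) u]
  gcongr
  exact (Finset.sum_le_sum fun i _ => le_max_left _ _).trans
    (Finset.sum_le_sum_of_subset_of_nonneg (Finset.filter_subset _ _)
      fun i _ _ => le_max_right _ _)

theorem topSum_succ_eq {n k : ℕ} (hk : k < n) (u : Fin n → ℝ) :
    topSum (k + 1) u = ((k + 1 : ℕ) : ℝ) * decSort u ⟨k, hk⟩ +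
      ∑ i, max (u i - decSort u ⟨k, hk⟩) 0 := by
  set t := decSort u ⟨k, hk⟩
  rw [topSum_eq_mul_add hk u t, ← sum_comp_decSort (fun z => max (z - t) 0) u,
    ← Finset.sum_subset (f := fun i => max (decSort u i - t) 0)
      (Finset.filter_subset (fun i : Fin n => (i : ℕ) < k + 1) _)]
  · congr 1
    refine Finset.sum_congr rfl fun i hi => (max_eq_left (sub_nonneg.2 ?_)).symm
    exact decSort_antitone u (Fin.le_def.2 (Nat.lt_succ_iff.1 (Finset.mem_filter.1 hi).2))
  · intro i _ hi
    refine max_eq_right (sub_nonpos.2 (decSort_antitone u (Fin.le_def.2 ?_)))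
    have : ¬ (i : ℕ) < k + 1 := by simpa using hi
    change k ≤ (i : ℕ)
    omega

/-- Comparison of the sums of `(· - t)⁺` for all `t` implies weak submajorization. -/
theorem WSubMaj.of_sum_max_le {n : ℕ} {u v : Fin n → ℝ}
    (huv : ∀ t, ∑ i, max (u i - t) 0 ≤ ∑ i, max (v i - t) 0) : WSubMaj u v := by
  intro k hk
  cases k with
  | zero => simp [topSum]
  | succ k =>
    rw [topSum_succ_eq hk v]
    exact (topSum_le_mul_add_sum hk u _).trans (add_le_add le_rfl (huv _))

/-- 6.C.4 in Marshall–Olkin, "if" direction: if `h` is supermodular and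
either increasing in each component or decreasing in each component, then
`(h(x_[1], y_[n]), …, h(x_[n], y_[1])) ≺_w (h(x₁,y₁), …, h(x_n,y_n))`. -/
theorem stmt9 {n : ℕ} (h : ℝ → ℝ → ℝ) (hsm : Supermod2 h)
    (hdir : ((∀ b, Monotone fun a => h a b) ∧ ∀ a, Monotone fun b => h a b) ∨
            ((∀ b, Antitone fun a => h a b) ∧ ∀ a, Antitone fun b => h a b))
    (x y : Fin n → ℝ) :
    WSubMaj (fun i => h (decSort x i) (incSort y i)) (fun i => h (x i) (y i)) := by
  exact WSubMaj.of_sum_max_le fun t => (hsm.max_sub_zero hdir t).sum_decSort_incSort_le x y
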